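/- arXiv:2507.13026 — 2 statements merged into one kernel-verified Lean document; each statement's English description precedes it below -/
import Mathlib

section
/- For n ∈ {6,7,8}, every pair of edge-disjoint Hamiltonian paths from 1 to n on {1,...,n}, with edge costs given by |j−k| for edge {j,k}, has total cost (sum of the two path costs) at least 16(n−1)/5. -/
/-- A Hamiltonian path on the vertex set `{1,…,n}` from vertex `1` to vertex `n`,
given as the sequence `p 0, p 1, …, p (n-1)` of visited vertices. -/
def IsHamPath (n : ℕ) (p : ℕ → ℕ) : Prop :=
  2 ≤ n ∧ p 0 = 1 ∧ p (n - 1) = n ∧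
  (∀ i, i < n → 1 ≤ p i ∧ p i ≤ n) ∧
  (∀ i j, i < n → j < n → p i = p j → i = j)

/-- The depth of the segment between `s` and `s+1` with respect to the path `p`:
the number of edges `{j,k}` (with `j < k`) of `p` such that `j ≤ s < k`. -/
def segDepth (n : ℕ) (p : ℕ → ℕ) (s : ℕ) : ℕ :=
  ((Finset.range (n - 1)).filter
    (fun i => min (p i) (p (i + 1)) ≤ s ∧ s < max (p i) (p (i + 1)))).card

/-- `{a, b}` is an (unordered) edge of the path `p`. -/
def IsEdgeOf (n : ℕ) (p : ℕ → ℕ) (a b : ℕ) : Prop :=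
  ∃ i, i < n - 1 ∧ ((p i = a ∧ p (i + 1) = b) ∨ (p i = b ∧ p (i + 1) = a))

/-- Two paths are edge-disjoint: they share no unordered edge. -/
def PathsEdgeDisjoint (n : ℕ) (p q : ℕ → ℕ) : Prop :=
  ∀ i, i < n - 1 → ¬ IsEdgeOf n q (p i) (p (i + 1))

/-- The cost of a path, where the edge `{j,k}` costs `|j - k|`. -/
def pathCost (n : ℕ) (p : ℕ → ℕ) : ℕ :=
  ∑ i ∈ Finset.range (n - 1), (max (p i) (p (i + 1)) - min (p i) (p (i + 1)))

/-- The vertex `v` is covered by the path `p`: some edge `{j,k}` of `p` has `j < v < k`. -/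
def CoversVertex (n : ℕ) (p : ℕ → ℕ) (v : ℕ) : Prop :=
  ∃ i, i < n - 1 ∧ min (p i) (p (i + 1)) < v ∧ v < max (p i) (p (i + 1))

/-- The edge lists of all paths with `k` edges that start at `v`, end at `n`, visit distinct
vertices of `avail` after `v`, cost at most `b` and use no edge of `F`. A partial path is dropped
when the remaining budget does not suffice for reaching `n`. -/
def lowCostPaths (n : ℕ) (F : List (ℕ × ℕ)) : ℕ → ℕ → ℕ → List ℕ → List (List (ℕ × ℕ))
  | 0, _, _, _ => [[]]
  | k + 1, b, v, avail => avail.flatMap fun w =>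
      if (max v w - min v w) + (n - w) ≤ b ∧
          F.any (fun e => (e.1 == v && e.2 == w) || (e.1 == w && e.2 == v)) = false then
        (lowCostPaths n F k (b - (max v w - min v w)) w (avail.erase w)).map ((v, w) :: ·)
      else []

/-- The list of edges of `p` in order of traversal, for a path with `k` edges. -/
def edgeList (k : ℕ) (p : ℕ → ℕ) : List (ℕ × ℕ) :=
  (List.range k).map fun i => (p i, p (i + 1))

/-- The cost of a list of edges. -/
def edgeListCost (L : List (ℕ × ℕ)) : ℕ :=
  (L.map fun e => max e.1 e.2 - min e.1 e.2).sum

lemma edgeListCost_edgeList (n : ℕ) (p : ℕ → ℕ) :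
    edgeListCost (edgeList (n - 1) p) = pathCost n p := by
  simp [edgeListCost, edgeList, pathCost, Finset.sum, Multiset.range, Function.comp_def]

lemma sub_le_sum_dist (k : ℕ) (p : ℕ → ℕ) :
    p k - p 0 ≤ ∑ i ∈ Finset.range k, (max (p i) (p (i + 1)) - min (p i) (p (i + 1))) := by
  induction k with
  | zero => simp
  | succ k ih => rw [Finset.sum_range_succ]; omega

lemma edgeList_mem_lowCostPaths (n : ℕ) (F : List (ℕ × ℕ)) (k : ℕ) :
    ∀ (b : ℕ) (p : ℕ → ℕ) (avail : List ℕ),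
      p k = n → (∀ i j, i ≤ k → j ≤ k → p i = p j → i = j) →
      (∀ i, i < k → p (i + 1) ∈ avail) →
      (∑ i ∈ Finset.range k, (max (p i) (p (i + 1)) - min (p i) (p (i + 1))) ≤ b) →
      (∀ i, i < k → ∀ e ∈ F, ¬ (e.1 = p i ∧ e.2 = p (i + 1)) ∧
        ¬ (e.1 = p (i + 1) ∧ e.2 = p i)) →
      edgeList k p ∈ lowCostPaths n F k b (p 0) avail := by
  induction k with
  | zero => intros; simp [edgeList, lowCostPaths]
  | succ k ih =>
    intro b p avail hend hinj hmem hcost hF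
    rw [Finset.sum_range_succ'] at hcost
    have hdist := sub_le_sum_dist k (fun i => p (i + 1))
    simp only [hend, zero_add] at hdist hcost
    rw [lowCostPaths, List.mem_flatMap]
    refine ⟨p 1, hmem 0 k.succ_pos, ?_⟩
    rw [if_pos]
    · refine List.mem_map.2 ⟨edgeList k fun i => p (i + 1), ?_, ?_⟩
      · refine ih _ (fun i => p (i + 1)) _ hend ?_ ?_ (by omega) ?_
        · intro i j hi hj h
          have := hinj (i + 1) (j + 1) (by omega) (by omega) h
          omega
        · intro i hi
          refine (List.mem_erase_of_ne ?_).2 (hmem (i + 1) (by omega))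
          intro h
          have := hinj (i + 1 + 1) 1 (by omega) (by omega) h
          omega
        · intro i hi
          exact hF (i + 1) (by omega)
      · simp [edgeList, List.range_succ_eq_map, Function.comp_def]
    · refine ⟨by omega, ?_⟩
      rw [List.any_eq_false]
      intro e he
      simpa using hF 0 k.succ_pos e he

lemma IsHamPath.edgeList_mem_lowCostPaths {n : ℕ} {p : ℕ → ℕ} (h : IsHamPath n p)
    (F : List (ℕ × ℕ)) {b : ℕ} (hb : pathCost n p ≤ b)
    (hF : ∀ i, i < n - 1 → ∀ e ∈ F, ¬ (e.1 = p i ∧ e.2 = p (i + 1)) ∧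
        ¬ (e.1 = p (i + 1) ∧ e.2 = p i)) :
    edgeList (n - 1) p ∈ lowCostPaths n F (n - 1) b 1 (List.range' 2 (n - 1)) := by
  obtain ⟨hn, h0, hlast, hrange, hinj⟩ := h
  refine h0 ▸ _root_.edgeList_mem_lowCostPaths n F (n - 1) b p (List.range' 2 (n - 1)) hlast
    (fun i j hi hj => hinj i j (by omega) (by omega)) ?_ hb hF
  intro i hi
  have hr := hrange (i + 1) (by omega)
  have hne : p (i + 1) ≠ p 0 := fun h => by
    have := hinj (i + 1) 0 (by omega) (by omega) h
    omega
  rw [List.mem_range'_1]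
  omega

lemma PathsEdgeDisjoint.symm {n : ℕ} {p q : ℕ → ℕ} (h : PathsEdgeDisjoint n p q) :
    PathsEdgeDisjoint n q p := by
  rintro i hi ⟨j, hj, hij⟩
  refine h j hj ⟨i, hi, ?_⟩
  grind

/-- Every path of cost at most `B / 2` meets all paths that, together with it, cost at most `B`. -/
def NoCheapDisjointPair (n B : ℕ) : Prop :=
  ∀ L ∈ lowCostPaths n [] (n - 1) (B / 2) 1 (List.range' 2 (n - 1)),
    (lowCostPaths n L (n - 1) (B - edgeListCost L) 1 (List.range' 2 (n - 1))).isEmpty = true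

instance (n B : ℕ) : Decidable (NoCheapDisjointPair n B) := by
  unfold NoCheapDisjointPair; infer_instance

lemma NoCheapDisjointPair.lt_pathCost_add {n B : ℕ} (hB : NoCheapDisjointPair n B)
    {p q : ℕ → ℕ} (hp : IsHamPath n p) (hq : IsHamPath n q) (hd : PathsEdgeDisjoint n p q) :
    B < pathCost n p + pathCost n q := by
  wlog hle : pathCost n p ≤ pathCost n q generalizing p q
  · rw [add_comm]
    exact this hq hp hd.symm (by omega)
  by_contra! hsum
  have hmem := hp.edgeList_mem_lowCostPaths [] (b := B / 2) (by omega) (by simp)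
  have hempty := hB _ hmem
  rw [edgeListCost_edgeList, List.isEmpty_iff] at hempty
  have hqmem := hq.edgeList_mem_lowCostPaths (edgeList (n - 1) p) (b := B - pathCost n p)
    (by omega) (by
      intro i hi e he
      obtain ⟨j, hj, rfl⟩ := List.mem_map.1 he
      have hji := hd j (List.mem_range.1 hj)
      exact ⟨fun h => hji ⟨i, hi, .inl ⟨h.1.symm, h.2.symm⟩⟩,
        fun h => hji ⟨i, hi, .inr ⟨h.2.symm, h.1.symm⟩⟩⟩)
  rw [hempty] at hqmem
  exact List.not_mem_nil hqmem

lemma noCheapDisjointPair_six : NoCheapDisjointPair 6 15 := by decide +kernel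

lemma noCheapDisjointPair_seven : NoCheapDisjointPair 7 19 := by decide +kernel

lemma noCheapDisjointPair_eight : NoCheapDisjointPair 8 22 := by decide +kernel

/-- for `n ∈ {6,7,8}` every pair of edge-disjoint Hamiltonian
(1,n)-paths has total cost at least `16(n-1)/5`. -/
theorem stmt_6 (n : ℕ) (hn : n ∈ ({6, 7, 8} : Set ℕ)) (p1 p2 : ℕ → ℕ)
    (h1 : IsHamPath n p1) (h2 : IsHamPath n p2)
    (hd : PathsEdgeDisjoint n p1 p2) :
    (16 : ℚ) * ((n : ℚ) - 1) / 5 ≤ ((pathCost n p1 + pathCost n p2 : ℕ) : ℚ) := by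
  rcases hn with rfl | rfl | rfl
  · have h : (16 : ℚ) ≤ ((pathCost 6 p1 + pathCost 6 p2 : ℕ) : ℚ) :=
      mod_cast noCheapDisjointPair_six.lt_pathCost_add h1 h2 hd
    push_cast at h ⊢
    linarith
  · have h : (20 : ℚ) ≤ ((pathCost 7 p1 + pathCost 7 p2 : ℕ) : ℚ) :=
      mod_cast noCheapDisjointPair_seven.lt_pathCost_add h1 h2 hd
    push_cast at h ⊢
    linarith
  · have h : (23 : ℚ) ≤ ((pathCost 8 p1 + pathCost 8 p2 : ℕ) : ℚ) :=
      mod_cast noCheapDisjointPair_eight.lt_pathCost_add h1 h2 hd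
    push_cast at h ⊢
    linarith
end

section
/- For every n ≥ 5, every pair of edge-disjoint odd-depth Hamiltonian cycles on n evenly spaced points on a circle of circumference n has total cost at least 16n/5; consequently, in any pair of edge-disjoint Hamiltonian cycles, the longer tour has cost at least (8/5)n. -/
/-- A Hamiltonian cycle (tour) on the vertices `0,…,n-1`, given as the cyclic
sequence `q 0, q 1, …, q (n-1)` (closing back to `q 0`). -/
def IsTour (n : ℕ) (q : ℕ → ℕ) : Prop :=
  0 < n ∧ (∀ i, i < n → q i < n) ∧ (∀ i j, i < n → j < n → q i = q j → i = j)

/-- Two tours are edge-disjoint: they share no unordered edge. -/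
def ToursEdgeDisjoint (n : ℕ) (q1 q2 : ℕ → ℕ) : Prop :=
  ∀ i j, i < n → j < n →
    ¬ ((q1 i = q2 j ∧ q1 ((i + 1) % n) = q2 ((j + 1) % n)) ∨
       (q1 i = q2 ((j + 1) % n) ∧ q1 ((i + 1) % n) = q2 j))

/-- Depth of the unit segment between vertex `s` and vertex `s+1 (mod n)` with
respect to the tour `q`, where each edge `i` of the tour is realized as the
clockwise arc from `q i` to `q (i+1)` when `c i = true`, and as the opposite
arc otherwise.  The clockwise arc from `a` to `b` covers segment `s` iff
`(s - a) % n < (b - a) % n`. -/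
def tourDepth (n : ℕ) (q : ℕ → ℕ) (c : ℕ → Bool) (s : ℕ) : ℕ :=
  ((Finset.range n).filter (fun i =>
    (c i = true ∧ (s + n - q i) % n < (q ((i + 1) % n) + n - q i) % n) ∨
    (c i = false ∧ (s + n - q ((i + 1) % n)) % n < (q i + n - q ((i + 1) % n)) % n))).card

/-- Distance between points `a` and `b` among `n` evenly spaced points on a
circle of circumference `n`: the shorter arc length. -/
def arcDist (n a b : ℕ) : ℕ := min ((b + n - a) % n) ((a + n - b) % n)

/-- Cost of a tour: sum of the (shorter-arc) lengths of its edges. -/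
def tourCost (n : ℕ) (q : ℕ → ℕ) : ℕ :=
  ∑ i ∈ Finset.range n, arcDist n (q i) (q ((i + 1) % n))

/-- The arc choice `c` realizes each edge of the tour `q` by a shortest arc. -/
def ShortestChoice (n : ℕ) (q : ℕ → ℕ) (c : ℕ → Bool) : Prop :=
  ∀ i, i < n →
    (if c i then (q ((i + 1) % n) + n - q i) % n else (q i + n - q ((i + 1) % n)) % n)
      = arcDist n (q i) (q ((i + 1) % n))

/-- The edges of a Hamiltonian cycle on `ZMod n`, each realized as the clockwise arc from `tail` to
`head`. -/
structure ArcTour (n : ℕ) [NeZero n] where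
  tail : ZMod n → ZMod n
  head : ZMod n → ZMod n
  tail_ne_head : ∀ i, tail i ≠ head i
  degree : ∀ v, (Finset.univ.filter fun i => tail i = v).card
    + (Finset.univ.filter fun i => head i = v).card = 2
  edge_injective : ∀ i j, s(tail i, head i) = s(tail j, head j) → i = j
  connected : ∀ A : ZMod n → Prop, (∀ i, A (tail i) ↔ A (head i)) → ∀ u v, A u → A v

theorem ZMod.val_add_one_eq_ite {n : ℕ} [NeZero n] (x : ZMod n) :
    (x + 1).val = if x.val + 1 = n then 0 else x.val + 1 := by
  have hx := x.val_lt
  rw [ZMod.val_add, ZMod.val_one_eq_one_mod, Nat.add_mod_mod]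
  split_ifs with h
  · rw [h, Nat.mod_self]
  · exact Nat.mod_eq_of_lt (by omega)

theorem ZMod.val_add_one_lt_iff {n : ℕ} [NeZero n] (x y : ZMod n) (hy : y ≠ 0) :
    (x + 1).val < y.val ↔ x + 1 = 0 ∨ (x.val < y.val ∧ x + 1 ≠ y) := by
  have hx := x.val_lt
  have hy' := y.val_lt
  have hy0 : y.val ≠ 0 := by rwa [Ne, ZMod.val_eq_zero]
  have h := ZMod.val_add_one_eq_ite x
  rw [← ZMod.val_eq_zero (x + 1), Ne, ← (ZMod.val_injective n).eq_iff (a := x + 1)]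
  split_ifs at h <;> omega

theorem ZMod.sum_comp_val {n : ℕ} [NeZero n] {M : Type*} [AddCommMonoid M] (f : ℕ → M) :
    ∑ i : ZMod n, f i.val = ∑ i ∈ Finset.range n, f i := by
  refine Finset.sum_nbij' ZMod.val (fun i => (i : ZMod n)) ?_ ?_ ?_ ?_ ?_
  · exact fun i _ => Finset.mem_range.2 i.val_lt
  · exact fun i _ => Finset.mem_univ _
  · exact fun i _ => ZMod.natCast_zmod_val i
  · exact fun i hi => ZMod.val_cast_of_lt (Finset.mem_range.1 hi)
  · exact fun i _ => rfl

theorem ZMod.card_val_sub_lt {n : ℕ} [NeZero n] (a : ZMod n) (k : ℕ) (hk : k ≤ n) :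
    (Finset.univ.filter fun s : ZMod n => (s - a).val < k).card = k := by
  have hshift := Equiv.sum_comp (Equiv.subRight a) fun s : ZMod n => if s.val < k then 1 else 0
  simp only [Equiv.subRight_apply] at hshift
  rw [Finset.card_filter, hshift,
    ZMod.sum_comp_val (fun s => if s < k then 1 else 0), ← Finset.card_filter]
  have : (Finset.range n).filter (· < k) = Finset.range k := by
    ext i; simp only [Finset.mem_filter, Finset.mem_range]; omega
  rw [this, Finset.card_range]

namespace ArcTour

variable {n : ℕ} [NeZero n] (T : ArcTour n)

/-- The edges covering the segment from `s` to `s + 1`. -/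
def cover (s : ZMod n) : Finset (ZMod n) :=
  Finset.univ.filter fun i => (s - T.tail i).val < (T.head i - T.tail i).val

/-- The edges leaving `v` clockwise. -/
def starts (v : ZMod n) : Finset (ZMod n) := Finset.univ.filter fun i => T.tail i = v

/-- The edges leaving `v` counterclockwise. -/
def ends (v : ZMod n) : Finset (ZMod n) := Finset.univ.filter fun i => T.head i = v

/-- The depth of the segment from `s` to `s + 1`. -/
def depth (s : ZMod n) : ℕ := (T.cover s).card

/-- `T` has an edge between `u` and `v`. -/
def HasEdge (u v : ZMod n) : Prop := ∃ i, s(T.tail i, T.head i) = s(u, v)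

theorem mem_cover {i s : ZMod n} :
    i ∈ T.cover s ↔ (s - T.tail i).val < (T.head i - T.tail i).val := by simp [cover]

theorem mem_starts {i v : ZMod n} : i ∈ T.starts v ↔ T.tail i = v := by simp [starts]

theorem mem_ends {i v : ZMod n} : i ∈ T.ends v ↔ T.head i = v := by simp [ends]

theorem mem_cover_succ {i s : ZMod n} :
    i ∈ T.cover (s + 1) ↔ i ∈ T.starts (s + 1) ∨ (i ∈ T.cover s ∧ i ∉ T.ends (s + 1)) := by
  have h := ZMod.val_add_one_lt_iff (s - T.tail i) (T.head i - T.tail i)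
    (sub_ne_zero.2 (T.tail_ne_head i).symm)
  rw [mem_cover, mem_cover, mem_starts, mem_ends, show s + 1 - T.tail i = s - T.tail i + 1 by ring,
    h, show s - T.tail i + 1 = s + 1 - T.tail i by ring, sub_eq_zero, Ne, sub_left_inj,
    eq_comm (a := s + 1), eq_comm (a := s + 1)]

theorem starts_subset_cover (s : ZMod n) : T.starts s ⊆ T.cover s := by
  intro i hi
  rw [mem_starts] at hi
  rw [mem_cover, hi, sub_self, ZMod.val_zero, Nat.pos_iff_ne_zero, Ne, ZMod.val_eq_zero, sub_eq_zero,
    ← hi]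
  exact (T.tail_ne_head i).symm

theorem ends_subset_cover (s : ZMod n) : T.ends (s + 1) ⊆ T.cover s := by
  intro i hi
  rw [mem_ends] at hi
  rw [mem_cover, hi, show s + 1 - T.tail i = s - T.tail i + 1 by ring, ZMod.val_add_one_eq_ite,
    if_neg, Nat.lt_succ_iff]
  intro h
  have h1 := ZMod.val_add_one_eq_ite (s - T.tail i)
  rw [if_pos h, ZMod.val_eq_zero, show s - T.tail i + 1 = s + 1 - T.tail i by ring, ← hi,
    sub_eq_zero] at h1
  exact T.tail_ne_head i h1.symm

theorem disjoint_starts_cover (s : ZMod n) : Disjoint (T.starts (s + 1)) (T.cover s) := by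
  rw [Finset.disjoint_left]
  intro i hi hc
  rw [mem_starts] at hi
  rw [mem_cover, hi, show s - (s + 1) = -1 by ring] at hc
  have h1 := ZMod.val_add_one_eq_ite (-1 : ZMod n)
  have h2 := (T.head i - (s + 1)).val_lt
  rw [neg_add_cancel, ZMod.val_zero] at h1
  split_ifs at h1
  omega

theorem cover_succ (s : ZMod n) :
    T.cover (s + 1) = T.starts (s + 1) ∪ (T.cover s \ T.ends (s + 1)) := by
  ext i
  rw [mem_cover_succ, Finset.mem_union, Finset.mem_sdiff]

theorem card_starts_add_card_ends (v : ZMod n) : (T.starts v).card + (T.ends v).card = 2 :=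
  T.degree v

theorem depth_succ (s : ZMod n) :
    T.depth (s + 1) + (T.ends (s + 1)).card = T.depth s + (T.starts (s + 1)).card := by
  have h1 := Finset.card_sdiff_add_card_eq_card (T.ends_subset_cover s)
  have h2 := Finset.card_union_of_disjoint
    ((T.disjoint_starts_cover s).mono_right (Finset.sdiff_subset (t := T.ends (s + 1))))
  rw [← cover_succ] at h2
  unfold depth
  omega

theorem hasEdge_of_mem {i u v : ZMod n} (hu : i ∈ T.starts u) (hv : i ∈ T.ends v) :
    T.HasEdge u v := ⟨i, by rw [(T.mem_starts).1 hu, (T.mem_ends).1 hv]⟩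

theorem starts_inter_ends_card_le (u v : ZMod n) : (T.starts u ∩ T.ends v).card ≤ 1 := by
  rw [Finset.card_le_one]
  intro i hi j hj
  rw [Finset.mem_inter, mem_starts, mem_ends] at hi hj
  exact T.edge_injective i j (by rw [hi.1, hi.2, hj.1, hj.2])

/-- Two sets of covering edges too large to be disjoint share an edge. -/
theorem hasEdge_of_card_lt {s u v : ZMod n} (hu : T.starts u ⊆ T.cover s)
    (hv : T.ends v ⊆ T.cover s) (h : T.depth s < (T.starts u).card + (T.ends v).card) :
    T.HasEdge u v := by
  obtain ⟨i, hi⟩ := Finset.inter_nonempty_of_card_lt_card_add_card hu hv h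
  rw [Finset.mem_inter] at hi
  exact T.hasEdge_of_mem hi.1 hi.2

theorem hasEdge_of_depth_one {s : ZMod n} (h0 : T.depth s = 1) (h1 : T.depth (s + 1) = 1)
    (h2 : T.depth (s + 1 + 1) = 1) : T.HasEdge (s + 1) (s + 1 + 1) := by
  have d1 := T.depth_succ s
  have d2 := T.depth_succ (s + 1)
  have e1 := T.card_starts_add_card_ends (s + 1)
  have e2 := T.card_starts_add_card_ends (s + 1 + 1)
  exact T.hasEdge_of_card_lt (T.starts_subset_cover _) (T.ends_subset_cover _) (by omega)

theorem hasEdge_of_depth_one_three_one {s : ZMod n} (h0 : T.depth s = 1)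
    (h1 : T.depth (s + 1) = 3) (h2 : T.depth (s + 1 + 1) = 1) :
    T.HasEdge (s + 1) (s + 1 + 1) := by
  have d1 := T.depth_succ s
  have d2 := T.depth_succ (s + 1)
  have e1 := T.card_starts_add_card_ends (s + 1)
  have e2 := T.card_starts_add_card_ends (s + 1 + 1)
  exact T.hasEdge_of_card_lt (T.starts_subset_cover _) (T.ends_subset_cover _) (by omega)

theorem hasEdge_of_depth_one_three_three_one {s : ZMod n} (h0 : T.depth s = 1)
    (h1 : T.depth (s + 1) = 3) (h2 : T.depth (s + 1 + 1) = 3)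
    (h3 : T.depth (s + 1 + 1 + 1) = 1) :
    T.HasEdge (s + 1) (s + 1 + 1) ∨ T.HasEdge (s + 1 + 1) (s + 1 + 1 + 1) := by
  have d1 := T.depth_succ s
  have d2 := T.depth_succ (s + 1)
  have d3 := T.depth_succ (s + 1 + 1)
  have e1 := T.card_starts_add_card_ends (s + 1)
  have e2 := T.card_starts_add_card_ends (s + 1 + 1)
  have e3 := T.card_starts_add_card_ends (s + 1 + 1 + 1)
  by_contra! hne
  have hsub : T.starts (s + 1) ⊆ T.cover (s + 1 + 1) := fun i hi => T.mem_cover_succ.2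
    (Or.inr ⟨T.starts_subset_cover _ hi, fun he => hne.1 (T.hasEdge_of_mem hi he)⟩)
  have hdisj : Disjoint (T.starts (s + 1 + 1)) (T.starts (s + 1)) :=
    (T.disjoint_starts_cover (s + 1)).mono_right (T.starts_subset_cover _)
  have hdisj' : Disjoint (T.starts (s + 1 + 1)) (T.ends (s + 1 + 1 + 1)) := by
    rw [Finset.disjoint_left]
    exact fun i hi he => hne.2 (T.hasEdge_of_mem hi he)
  have hcard := Finset.card_le_card (Finset.union_subset (T.starts_subset_cover (s + 1 + 1))
    (Finset.union_subset hsub (T.ends_subset_cover (s + 1 + 1))))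
  rw [Finset.card_union_of_disjoint (Finset.disjoint_union_right.2 ⟨hdisj, hdisj'⟩)] at hcard
  have hui := Finset.card_union_add_card_inter (T.starts (s + 1)) (T.ends (s + 1 + 1 + 1))
  have hle := T.starts_inter_ends_card_le (s + 1) (s + 1 + 1 + 1)
  change _ ≤ T.depth _ at hcard
  omega

theorem hasEdge_of_depth_one_three_one_one {s : ZMod n} (h0 : T.depth s = 1)
    (h1 : T.depth (s + 1) = 3) (h2 : T.depth (s + 1 + 1) = 1)
    (h3 : T.depth (s + 1 + 1 + 1) = 1) : T.HasEdge (s + 1) (s + 1 + 1 + 1) := by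
  have d1 := T.depth_succ s
  have d2 := T.depth_succ (s + 1)
  have d3 := T.depth_succ (s + 1 + 1)
  have e1 := T.card_starts_add_card_ends (s + 1)
  have e2 := T.card_starts_add_card_ends (s + 1 + 1)
  have e3 := T.card_starts_add_card_ends (s + 1 + 1 + 1)
  have hle := T.starts_inter_ends_card_le (s + 1) (s + 1 + 1)
  have hui := Finset.card_sdiff_add_card_inter (T.starts (s + 1)) (T.ends (s + 1 + 1))
  have hsub : T.starts (s + 1) \ T.ends (s + 1 + 1) ⊆ T.cover (s + 1 + 1) := fun i hi =>
    T.mem_cover_succ.2 (Or.inr ⟨T.starts_subset_cover _ (Finset.mem_sdiff.1 hi).1,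
      (Finset.mem_sdiff.1 hi).2⟩)
  obtain ⟨i, hi⟩ := Finset.inter_nonempty_of_card_lt_card_add_card hsub
    (T.ends_subset_cover (s + 1 + 1)) (by change T.depth _ < _; omega)
  rw [Finset.mem_inter, Finset.mem_sdiff] at hi
  exact T.hasEdge_of_mem hi.1.1 hi.2

theorem hasEdge_of_depth_one_one_three_one {s : ZMod n} (h0 : T.depth s = 1)
    (h1 : T.depth (s + 1) = 1) (h2 : T.depth (s + 1 + 1) = 3)
    (h3 : T.depth (s + 1 + 1 + 1) = 1) : T.HasEdge (s + 1) (s + 1 + 1 + 1) := by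
  have d1 := T.depth_succ s
  have d2 := T.depth_succ (s + 1)
  have d3 := T.depth_succ (s + 1 + 1)
  have e1 := T.card_starts_add_card_ends (s + 1)
  have e2 := T.card_starts_add_card_ends (s + 1 + 1)
  have e3 := T.card_starts_add_card_ends (s + 1 + 1 + 1)
  have hempty : T.ends (s + 1 + 1) = ∅ := Finset.card_eq_zero.1 (by omega)
  have hsub : T.starts (s + 1) ⊆ T.cover (s + 1 + 1) := fun i hi => T.mem_cover_succ.2
    (Or.inr ⟨T.starts_subset_cover _ hi, by simp [hempty]⟩)
  have hdisj : Disjoint (T.starts (s + 1 + 1)) (T.starts (s + 1)) :=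
    (T.disjoint_starts_cover (s + 1)).mono_right (T.starts_subset_cover _)
  by_contra hne
  have hdisj' : Disjoint (T.starts (s + 1)) (T.ends (s + 1 + 1 + 1)) := by
    rw [Finset.disjoint_left]
    exact fun i hi he => hne (T.hasEdge_of_mem hi he)
  have hcard := Finset.card_le_card (Finset.union_subset hsub
    (Finset.union_subset (T.starts_subset_cover (s + 1 + 1)) (T.ends_subset_cover (s + 1 + 1))))
  rw [Finset.card_union_of_disjoint (Finset.disjoint_union_right.2 ⟨hdisj.symm, hdisj'⟩)] at hcard
  have hui := Finset.card_union_add_card_inter (T.starts (s + 1 + 1)) (T.ends (s + 1 + 1 + 1))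
  have hle := T.starts_inter_ends_card_le (s + 1 + 1) (s + 1 + 1 + 1)
  change _ ≤ T.depth _ at hcard
  omega

/-- The total length of the arcs. -/
def cost : ℕ := ∑ i, (T.head i - T.tail i).val

theorem sum_depth : ∑ s, T.depth s = T.cost := by
  unfold depth cost cover
  simp_rw [Finset.card_filter]
  rw [Finset.sum_comm]
  refine Finset.sum_congr rfl fun i _ => ?_
  rw [← Finset.card_filter]
  exact ZMod.card_val_sub_lt _ _ (ZMod.val_lt _).le

theorem odd_depth_succ_iff (s : ZMod n) : Odd (T.depth (s + 1)) ↔ Odd (T.depth s) := by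
  have d := T.depth_succ s
  have e := T.card_starts_add_card_ends (s + 1)
  rw [Nat.odd_iff, Nat.odd_iff]
  omega

theorem odd_depth_iff (s t : ZMod n) : Odd (T.depth s) ↔ Odd (T.depth t) := by
  have h : ∀ k : ℕ, Odd (T.depth (t + k)) ↔ Odd (T.depth t) := by
    intro k
    induction k with
    | zero => simp
    | succ k ih => rw [← ih, Nat.cast_succ, ← add_assoc, odd_depth_succ_iff]
  rw [← h (s - t).val, ZMod.natCast_zmod_val, add_sub_cancel]

/-- A property that changes only across uncovered segments is constant along each arc. -/
theorem tail_iff_head {A : ZMod n → Prop} {i : ZMod n}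
    (hA : ∀ w, i ∈ T.cover w → (A w ↔ A (w + 1))) : A (T.tail i) ↔ A (T.head i) := by
  have h : ∀ k : ℕ, k ≤ (T.head i - T.tail i).val → (A (T.tail i) ↔ A (T.tail i + k)) := by
    intro k
    induction k with
    | zero => simp
    | succ k ih =>
      intro hk
      rw [ih (by omega), Nat.cast_succ, ← add_assoc]
      apply hA
      rw [mem_cover, add_sub_cancel_left, ZMod.val_cast_of_lt]
      · omega
      · exact hk.trans (ZMod.val_lt _).le
  have := h _ le_rfl
  rwa [ZMod.natCast_zmod_val, add_sub_cancel] at this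

theorem eq_of_depth_eq_zero {s t : ZMod n} (hs : T.depth s = 0) (ht : T.depth t = 0) : s = t := by
  by_contra hst
  have hs' := Finset.card_eq_zero.1 hs
  have ht' := Finset.card_eq_zero.1 ht
  have hpos : t - s ≠ 0 := sub_ne_zero.2 (Ne.symm hst)
  have hlt := (t - s).val_lt
  refine absurd (T.connected (fun v => (v - (s + 1)).val < (t - s).val) (fun i =>
    T.tail_iff_head (A := fun v => (v - (s + 1)).val < (t - s).val) fun w hw => ?_) (s + 1) s ?_) ?_
  · have hws : w ≠ s := by rintro rfl; simp [hs'] at hw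
    have hwt : w ≠ t := by rintro rfl; simp [ht'] at hw
    have h := ZMod.val_add_one_lt_iff (w - (s + 1)) (t - s) hpos
    rw [show w + 1 - (s + 1) = w - (s + 1) + 1 by ring, h]
    rw [show w - (s + 1) + 1 = w - s by ring, sub_eq_zero, Ne, sub_left_inj]
    tauto
  · rw [sub_self, ZMod.val_zero]
    exact Nat.pos_of_ne_zero (by rwa [Ne, ZMod.val_eq_zero])
  · rw [show s - (s + 1) = -1 by ring]
    have h1 := ZMod.val_add_one_eq_ite (-1 : ZMod n)
    rw [neg_add_cancel, ZMod.val_zero] at h1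
    split_ifs at h1
    omega

theorem le_cost_of_not_odd (h : ∀ s, ¬ Odd (T.depth s)) : 2 * n ≤ T.cost + 2 := by
  have hzero : (Finset.univ.filter fun s => T.depth s = 0).card ≤ 1 := by
    rw [Finset.card_le_one]
    intro s hs t ht
    rw [Finset.mem_filter] at hs ht
    exact T.eq_of_depth_eq_zero hs.2 ht.2
  have hsum : ∑ _s : ZMod n, 2 ≤ ∑ s, (T.depth s + 2 * if T.depth s = 0 then 1 else 0) := by
    refine Finset.sum_le_sum fun s _ => ?_
    have := h s
    rw [Nat.odd_iff] at this
    split_ifs <;> omega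
  rw [Finset.sum_add_distrib, ← Finset.mul_sum, ← Finset.card_filter, sum_depth, Finset.sum_const,
    Finset.card_univ, ZMod.card, smul_eq_mul] at hsum
  omega

end ArcTour

/-- Averaging bound for circular sequences of even numbers avoiding the patterns `222`, `242` and
`2442`. -/
theorem sixteen_mul_le_sum_of_avoids {n : ℕ} [NeZero n] (D : ZMod n → ℕ) (heven : ∀ s, Even (D s))
    (hpos : ∀ s, 2 ≤ D s)
    (h222 : ∀ s, ¬ (D s = 2 ∧ D (s + 1) = 2 ∧ D (s + 1 + 1) = 2))
    (h242 : ∀ s, ¬ (D s = 2 ∧ D (s + 1) = 4 ∧ D (s + 1 + 1) = 2))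
    (h2442 : ∀ s, ¬ (D s = 2 ∧ D (s + 1) = 4 ∧ D (s + 1 + 1) = 4 ∧ D (s + 1 + 1 + 1) = 2)) :
    16 * n ≤ 5 * ∑ s, D s := by
  -- `P s` bounds from below the excess over the average `16 / 5`, scaled by `5`, of a stretch
  -- ending with the segments `s`, `s + 1`, `s + 2`.
  let P : ZMod n → ℤ := fun s =>
    if D (s + 1 + 1) = 2 then (if D (s + 1) = 2 then -12 else -6)
    else if D (s + 1 + 1) = 4 then
      (if D (s + 1) = 2 then -8 else if D (s + 1) = 4 ∧ D s = 2 then -4 else 0)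
    else 0
  have hP : ∀ s, P (s + 1) + 16 ≤ P s + 5 * D (s + 1 + 1 + 1) := by
    intro s
    have a0 := hpos s
    have a1 := hpos (s + 1)
    have a2 := hpos (s + 1 + 1)
    have a3 := hpos (s + 1 + 1 + 1)
    have b := heven (s + 1 + 1 + 1)
    have c := h222 (s + 1)
    have d := h242 (s + 1)
    have e := h2442 s
    rw [Nat.even_iff] at b
    simp only [P]
    split_ifs <;> omega
  have hPshift : ∑ s, P (s + 1) = ∑ s, P s := Equiv.sum_comp (Equiv.addRight (1 : ZMod n)) P
  have hsum := Finset.sum_le_sum fun s (_ : s ∈ Finset.univ) => hP s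
  rw [Finset.sum_add_distrib, Finset.sum_add_distrib, ← Finset.mul_sum,
    hPshift] at hsum
  have hshift : ∑ s : ZMod n, (D (s + 1 + 1 + 1) : ℤ) = ∑ s, (D s : ℤ) := by
    rw [← Equiv.sum_comp (Equiv.addRight (1 + 1 + 1 : ZMod n)) fun s => (D s : ℤ)]
    simp only [Equiv.coe_addRight, add_assoc]
  rw [hshift, Finset.sum_const, Finset.card_univ, ZMod.card, nsmul_eq_mul] at hsum
  zify
  linarith

theorem ArcTour.sixteen_mul_le_cost_add_cost {n : ℕ} [NeZero n] (T U : ArcTour n)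
    (hdisj : ∀ u v, T.HasEdge u v → ¬ U.HasEdge u v)
    (hT : ∀ s, Odd (T.depth s)) (hU : ∀ s, Odd (U.depth s)) :
    16 * n ≤ 5 * (T.cost + U.cost) := by
  have hT' : ∀ s, T.depth s % 2 = 1 := fun s => Nat.odd_iff.1 (hT s)
  have hU' : ∀ s, U.depth s % 2 = 1 := fun s => Nat.odd_iff.1 (hU s)
  have no242 : ∀ T U : ArcTour n, (∀ u v, T.HasEdge u v → ¬ U.HasEdge u v) → ∀ s,
      T.depth s = 1 → U.depth s = 1 → T.depth (s + 1) = 1 → U.depth (s + 1) = 3 →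
      T.depth (s + 1 + 1) = 1 → U.depth (s + 1 + 1) = 1 → False :=
    fun T U h s t0 u0 t1 u1 t2 u2 => h _ _ (T.hasEdge_of_depth_one t0 t1 t2)
      (U.hasEdge_of_depth_one_three_one u0 u1 u2)
  have no2442 : ∀ T U : ArcTour n, (∀ u v, T.HasEdge u v → ¬ U.HasEdge u v) → ∀ s,
      T.depth s = 1 → U.depth s = 1 → T.depth (s + 1) = 1 → U.depth (s + 1) = 3 →
      T.depth (s + 1 + 1) + U.depth (s + 1 + 1) = 4 →
      T.depth (s + 1 + 1) % 2 = 1 → U.depth (s + 1 + 1) % 2 = 1 →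
      T.depth (s + 1 + 1 + 1) = 1 → U.depth (s + 1 + 1 + 1) = 1 → False := by
    intro T U h s t0 u0 t1 u1 h2 t2 u2 t3 u3
    obtain h2' | h2' : T.depth (s + 1 + 1) = 1 ∨ U.depth (s + 1 + 1) = 1 := by omega
    · obtain he | he := U.hasEdge_of_depth_one_three_three_one u0 u1 (by omega) u3
      · exact h _ _ (T.hasEdge_of_depth_one t0 t1 h2') he
      · exact h _ _ (T.hasEdge_of_depth_one t1 h2' t3) he
    · exact h _ _ (T.hasEdge_of_depth_one_one_three_one t0 t1 (by omega) t3)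
        (U.hasEdge_of_depth_one_three_one_one u0 u1 h2' u3)
  have hdisj' : ∀ u v, U.HasEdge u v → ¬ T.HasEdge u v := fun u v hu ht => hdisj u v ht hu
  rw [← T.sum_depth, ← U.sum_depth, ← Finset.sum_add_distrib]
  apply sixteen_mul_le_sum_of_avoids
  · exact fun s => (hT s).add_odd (hU s)
  · intro s
    have := hT' s
    have := hU' s
    omega
  · rintro s ⟨h0, h1, h2⟩
    have := hT' s; have := hT' (s + 1); have := hT' (s + 1 + 1)
    have := hU' s; have := hU' (s + 1); have := hU' (s + 1 + 1)
    exact hdisj _ _ (T.hasEdge_of_depth_one (s := s) (by omega) (by omega) (by omega))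
      (U.hasEdge_of_depth_one (by omega) (by omega) (by omega))
  · rintro s ⟨h0, h1, h2⟩
    have := hT' s; have := hT' (s + 1); have := hT' (s + 1 + 1)
    have := hU' s; have := hU' (s + 1); have := hU' (s + 1 + 1)
    obtain h | h : T.depth (s + 1) = 1 ∨ U.depth (s + 1) = 1 := by omega
    · apply no242 T U hdisj s <;> omega
    · apply no242 U T hdisj' s <;> omega
  · rintro s ⟨h0, h1, h2, h3⟩
    have := hT' s; have := hT' (s + 1); have := hT' (s + 1 + 1); have := hT' (s + 1 + 1 + 1)
    have := hU' s; have := hU' (s + 1); have := hU' (s + 1 + 1); have := hU' (s + 1 + 1 + 1)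
    obtain h | h : T.depth (s + 1) = 1 ∨ U.depth (s + 1) = 1 := by omega
    · apply no2442 T U hdisj s <;> omega
    · apply no2442 U T hdisj' s <;> omega

/-- The arcs of the tour visiting `p 0, p 1, …` in this order, the `i`-th edge being directed
clockwise from `p i` to `p (i + 1)` if `c i` holds, and from `p (i + 1)` to `p i` otherwise. -/
def ArcTour.ofInjective {n : ℕ} [NeZero n] (hn : 3 ≤ n) (p : ZMod n → ZMod n)
    (hp : Function.Injective p) (c : ZMod n → Bool) : ArcTour n where
  tail i := if c i then p i else p (i + 1)
  head i := if c i then p (i + 1) else p i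
  tail_ne_head i := by
    have hone : (1 : ZMod n) ≠ 0 := by
      rw [Ne, ← Nat.cast_one, ZMod.natCast_eq_zero_iff]
      exact fun h => by have := Nat.le_of_dvd one_pos h; omega
    have : p i ≠ p (i + 1) := hp.ne (by simpa using hone)
    split_ifs
    exacts [this, this.symm]
  degree v := by
    have hp' := Finite.injective_iff_bijective.1 hp
    have h1 : (Finset.univ.filter fun i => p i = v).card = 1 := by
      obtain ⟨i, hi, hu⟩ := hp'.existsUnique v
      exact Finset.card_eq_one.2 ⟨i, by ext j; simpa using ⟨hu j, fun h => h ▸ hi⟩⟩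
    have h2 : ∑ i, (if p (i + 1) = v then 1 else 0) = ∑ i, if p i = v then 1 else 0 :=
      Equiv.sum_comp (Equiv.addRight (1 : ZMod n)) fun i => if p i = v then 1 else 0
    rw [Finset.card_filter] at h1
    rw [Finset.card_filter, Finset.card_filter, ← Finset.sum_add_distrib,
      ← show ∑ i, ((if p i = v then 1 else 0) + if p (i + 1) = v then 1 else 0) = 2 by
        rw [Finset.sum_add_distrib, h2, h1]]
    refine Finset.sum_congr rfl fun i _ => ?_
    cases c i
    · exact add_comm _ _
    · rfl
  edge_injective i j h := by
    have hedge : ∀ i, s(if c i then p i else p (i + 1), if c i then p (i + 1) else p i) =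
        s(p i, p (i + 1)) := by
      intro i
      cases c i
      · exact Sym2.eq_swap
      · rfl
    rw [hedge, hedge, Sym2.eq_iff] at h
    simp only [hp.eq_iff] at h
    obtain h | ⟨h, h'⟩ := h
    · exact h.1
    · have h2 : ((2 : ℕ) : ZMod n) = 0 := by
        rw [h] at h'
        push_cast
        linear_combination h'
      rw [ZMod.natCast_eq_zero_iff] at h2
      have := Nat.le_of_dvd two_pos h2
      omega
  connected A hA u v := by
    have hstep : ∀ i, A (p i) ↔ A (p (i + 1)) := by
      intro i
      have := hA i
      cases hc : c i <;> simp only [hc] at this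
      · exact this.symm
      · exact this
    have hall : ∀ k : ℕ, A (p k) ↔ A (p 0) := by
      intro k
      induction k with
      | zero => simp
      | succ k ih => rw [Nat.cast_succ, ← hstep, ih]
    have hall' : ∀ w, A w ↔ A (p 0) := by
      intro w
      obtain ⟨i, rfl⟩ := (Finite.injective_iff_surjective.1 hp) w
      rw [← hall i.val, ZMod.natCast_zmod_val]
    exact fun h => (hall' v).2 ((hall' u).1 h)

theorem ZMod.val_natCast_sub_natCast {n : ℕ} [NeZero n] (a : ℕ) {b : ℕ} (hb : b < n) :
    ((a : ZMod n) - b).val = (a + n - b) % n := by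
  rw [← ZMod.val_natCast, Nat.cast_sub (by omega), Nat.cast_add, ZMod.natCast_self, add_zero]

theorem ZMod.val_add_one_eq_mod {n : ℕ} [NeZero n] (i : ZMod n) : (i + 1).val = (i.val + 1) % n := by
  rw [ZMod.val_add, ZMod.val_one_eq_one_mod, Nat.add_mod_mod]

namespace IsTour

variable {n : ℕ} [NeZero n] {q : ℕ → ℕ}

theorem injective_natCast (hq : IsTour n q) :
    Function.Injective fun i : ZMod n => (q i.val : ZMod n) := by
  intro i j h
  have h' := congrArg ZMod.val h
  rw [ZMod.val_cast_of_lt (hq.2.1 _ i.val_lt), ZMod.val_cast_of_lt (hq.2.1 _ j.val_lt)] at h'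
  exact ZMod.val_injective n (hq.2.2 _ _ i.val_lt j.val_lt h')

/-- The arcs of the tour `q` for the arc choice `c`. -/
def arcTour (hq : IsTour n q) (hn : 3 ≤ n) (c : ℕ → Bool) : ArcTour n :=
  .ofInjective hn _ hq.injective_natCast fun i => c i.val

variable (hq : IsTour n q) (hn : 3 ≤ n) (c : ℕ → Bool)

theorem arcTour_tail (i : ZMod n) : (hq.arcTour hn c).tail i =
    if c i.val then (q i.val : ZMod n) else (q ((i.val + 1) % n) : ZMod n) := by
  rw [← ZMod.val_add_one_eq_mod]
  rfl

theorem arcTour_head (i : ZMod n) : (hq.arcTour hn c).head i =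
    if c i.val then (q ((i.val + 1) % n) : ZMod n) else (q i.val : ZMod n) := by
  rw [← ZMod.val_add_one_eq_mod]
  rfl

theorem arcTour_depth {s : ℕ} : (hq.arcTour hn c).depth s = tourDepth n q c s := by
  unfold ArcTour.depth ArcTour.cover tourDepth
  rw [Finset.card_filter, Finset.card_filter, ← ZMod.sum_comp_val]
  refine Finset.sum_congr rfl fun i _ => ?_
  have h0 := hq.2.1 _ i.val_lt
  have h1 := hq.2.1 _ (Nat.mod_lt (i.val + 1) (NeZero.pos n))
  rw [arcTour_tail, arcTour_head]
  cases hc : c i.val <;>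
    simp [ZMod.val_natCast_sub_natCast _ h0, ZMod.val_natCast_sub_natCast _ h1]

theorem arcTour_cost (hc : ShortestChoice n q c) : (hq.arcTour hn c).cost = tourCost n q := by
  unfold ArcTour.cost tourCost
  rw [← ZMod.sum_comp_val]
  refine Finset.sum_congr rfl fun i _ => ?_
  have h0 := hq.2.1 _ i.val_lt
  have h1 := hq.2.1 _ (Nat.mod_lt (i.val + 1) (NeZero.pos n))
  rw [← hc i.val i.val_lt, arcTour_tail, arcTour_head]
  cases hc : c i.val <;>
    simp [ZMod.val_natCast_sub_natCast _ h0, ZMod.val_natCast_sub_natCast _ h1]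

theorem exists_of_hasEdge {u v : ZMod n} (h : (hq.arcTour hn c).HasEdge u v) :
    ∃ i < n, s(q i, q ((i + 1) % n)) = s(u.val, v.val) := by
  obtain ⟨i, hi⟩ := h
  refine ⟨i.val, i.val_lt, ?_⟩
  have h := congrArg (Sym2.map ZMod.val) hi
  rw [Sym2.map_mk, Sym2.map_mk, arcTour_tail, arcTour_head] at h
  rw [← h]
  have h0 := ZMod.val_cast_of_lt (hq.2.1 _ i.val_lt)
  have h1 := ZMod.val_cast_of_lt (hq.2.1 _ (Nat.mod_lt (i.val + 1) (NeZero.pos n)))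
  cases c i.val <;> simp [h0, h1]

end IsTour

theorem ToursEdgeDisjoint.not_hasEdge {n : ℕ} [NeZero n] {q1 q2 : ℕ → ℕ}
    (h : ToursEdgeDisjoint n q1 q2) (hq1 : IsTour n q1) (hq2 : IsTour n q2) (hn : 3 ≤ n)
    (c1 c2 : ℕ → Bool) (u v : ZMod n) (hu : (hq1.arcTour hn c1).HasEdge u v) :
    ¬ (hq2.arcTour hn c2).HasEdge u v := by
  intro hv
  obtain ⟨i, hi, h1⟩ := hq1.exists_of_hasEdge hn c1 hu
  obtain ⟨j, hj, h2⟩ := hq2.exists_of_hasEdge hn c2 hv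
  exact h i j hi hj (Sym2.eq_iff.1 (h1.trans h2.symm))

theorem exists_shortestChoice (n : ℕ) (q : ℕ → ℕ) : ∃ c, ShortestChoice n q c := by
  refine ⟨fun i => decide ((q ((i + 1) % n) + n - q i) % n ≤ (q i + n - q ((i + 1) % n)) % n),
    fun i _ => ?_⟩
  unfold arcDist
  simp only [decide_eq_true_eq]
  split_ifs with h
  · exact (min_eq_left h).symm
  · exact (min_eq_right (not_le.1 h).le).symm

/-- for `n ≥ 5`, (a) every pair of edge-disjoint odd-depth tours
on `S_n^1` has total cost at least `16n/5`; (b) consequently, in any pair of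
edge-disjoint tours the longer tour has cost at least `(8/5)n`. -/
theorem stmt_14 (n : ℕ) (hn : 5 ≤ n) :
    (∀ (q1 q2 : ℕ → ℕ) (c1 c2 : ℕ → Bool),
      IsTour n q1 → IsTour n q2 → ToursEdgeDisjoint n q1 q2 →
      ShortestChoice n q1 c1 → ShortestChoice n q2 c2 →
      (∀ s, s < n → Odd (tourDepth n q1 c1 s)) →
      (∀ s, s < n → Odd (tourDepth n q2 c2 s)) →
      (16 : ℚ) * (n : ℚ) / 5 ≤ ((tourCost n q1 + tourCost n q2 : ℕ) : ℚ)) ∧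
    (∀ q1 q2 : ℕ → ℕ, IsTour n q1 → IsTour n q2 → ToursEdgeDisjoint n q1 q2 →
      (8 : ℚ) * (n : ℚ) / 5 ≤ ((max (tourCost n q1) (tourCost n q2) : ℕ) : ℚ)) := by
  have : NeZero n := ⟨by omega⟩
  have hn3 : 3 ≤ n := by omega
  have hpair : ∀ (q1 q2 : ℕ → ℕ) (c1 c2 : ℕ → Bool),
      IsTour n q1 → IsTour n q2 → ToursEdgeDisjoint n q1 q2 →
      ShortestChoice n q1 c1 → ShortestChoice n q2 c2 →
      (∀ s, s < n → Odd (tourDepth n q1 c1 s)) →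
      (∀ s, s < n → Odd (tourDepth n q2 c2 s)) →
      16 * n ≤ 5 * (tourCost n q1 + tourCost n q2) := by
    intro q1 q2 c1 c2 hq1 hq2 hd hc1 hc2 ho1 ho2
    rw [← hq1.arcTour_cost hn3 c1 hc1, ← hq2.arcTour_cost hn3 c2 hc2]
    refine ArcTour.sixteen_mul_le_cost_add_cost _ _ (hd.not_hasEdge hq1 hq2 hn3 c1 c2)
      (fun s => ?_) (fun s => ?_)
    · rw [← ZMod.natCast_zmod_val s, hq1.arcTour_depth]
      exact ho1 _ s.val_lt
    · rw [← ZMod.natCast_zmod_val s, hq2.arcTour_depth]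
      exact ho2 _ s.val_lt
  have hone : ∀ (q : ℕ → ℕ) (c : ℕ → Bool), IsTour n q → ShortestChoice n q c →
      (∀ s, s < n → Odd (tourDepth n q c s)) ∨ 2 * n ≤ tourCost n q + 2 := by
    intro q c hq hc
    by_cases h : Odd ((hq.arcTour hn3 c).depth 0)
    · left
      intro s _
      rw [← hq.arcTour_depth hn3]
      exact (ArcTour.odd_depth_iff _ _ _).1 h
    · right
      rw [← hq.arcTour_cost hn3 c hc]
      exact ArcTour.le_cost_of_not_odd _ fun s hs => h ((ArcTour.odd_depth_iff _ _ _).1 hs)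
  constructor
  · intro q1 q2 c1 c2 hq1 hq2 hd hc1 hc2 ho1 ho2
    have h := hpair q1 q2 c1 c2 hq1 hq2 hd hc1 hc2 ho1 ho2
    rw [div_le_iff₀ (by norm_num)]
    exact_mod_cast (by omega : 16 * n ≤ (tourCost n q1 + tourCost n q2) * 5)
  · intro q1 q2 hq1 hq2 hd
    obtain ⟨c1, hc1⟩ := exists_shortestChoice n q1
    obtain ⟨c2, hc2⟩ := exists_shortestChoice n q2
    have h : 8 * n ≤ max (tourCost n q1) (tourCost n q2) * 5 := by
      obtain h1 | h1 := hone q1 c1 hq1 hc1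
      · obtain h2 | h2 := hone q2 c2 hq2 hc2
        · have := hpair q1 q2 c1 c2 hq1 hq2 hd hc1 hc2 h1 h2
          omega
        · omega
      · omega
    rw [div_le_iff₀ (by norm_num)]
    exact_mod_cast h
end
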